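/- For every m ≥ 1, p_{231,132}(2m) = 2^{m−1}, and for every m ≥ 0, p_{231,132}(2m+1) = 2^m. -/

import Mathlib

open Finset

/-- A permutation `π` of `Fin n` contains the length-3 pattern `σ`
(given as a permutation of `Fin 3`, read as the word `σ 0, σ 1, σ 2`). -/
def Pattern3 {n : ℕ} (σ : Equiv.Perm (Fin 3)) (π : Equiv.Perm (Fin n)) : Prop :=
  ∃ f : Fin 3 → Fin n, StrictMono f ∧ ∀ a b : Fin 3, σ a < σ b ↔ π (f a) < π (f b)

/-- The pattern 123. -/
def pat123 : Equiv.Perm (Fin 3) := 1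
/-- The pattern 132. -/
def pat132 : Equiv.Perm (Fin 3) := Equiv.swap 1 2
/-- The pattern 213. -/
def pat213 : Equiv.Perm (Fin 3) := Equiv.swap 0 1
/-- The pattern 231. -/
def pat231 : Equiv.Perm (Fin 3) := finRotate 3
/-- The pattern 312. -/
def pat312 : Equiv.Perm (Fin 3) := (finRotate 3)⁻¹
/-- The pattern 321. -/
def pat321 : Equiv.Perm (Fin 3) := Equiv.swap 0 2

/-- Mod-k-alternating: `π(i) ≡ i (mod k)` (1-based; equivalently 0-based). -/
def ModKAlt {n : ℕ} (k : ℕ) (π : Equiv.Perm (Fin n)) : Prop :=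
  ∀ i : Fin n, (π i : ℕ) % k = (i : ℕ) % k

/-- `π(i) ≡ r + i − 1 (mod k)` for all `i ∈ [n]` (1-based). -/
def ModKAltR {n : ℕ} (k r : ℕ) (π : Equiv.Perm (Fin n)) : Prop :=
  ∀ i : Fin n, ((π i : ℕ) + 1) % k = (r + (i : ℕ)) % k

/-- `mp_σ(n,k)`: number of mod-k-alternating permutations of `[n]` avoiding `σ`. -/
noncomputable def mpPat (k : ℕ) (σ : Equiv.Perm (Fin 3)) (n : ℕ) : ℕ :=
  Nat.card {π : Equiv.Perm (Fin n) // ModKAlt k π ∧ ¬ Pattern3 σ π}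

/-- `mp_σ(n,k,r)`: number of permutations in `MP(n,k,r)` avoiding `σ`. -/
noncomputable def mpPatR (k r : ℕ) (σ : Equiv.Perm (Fin 3)) (n : ℕ) : ℕ :=
  Nat.card {π : Equiv.Perm (Fin n) // ModKAltR k r π ∧ ¬ Pattern3 σ π}

/-- `mp_{σ,τ}(n,k)`: number of mod-k-alternating permutations of `[n]` avoiding both `σ` and `τ`. -/
noncomputable def mpPat2 (k : ℕ) (σ τ : Equiv.Perm (Fin 3)) (n : ℕ) : ℕ :=
  Nat.card {π : Equiv.Perm (Fin n) // ModKAlt k π ∧ ¬ Pattern3 σ π ∧ ¬ Pattern3 τ π}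

/-- The revflip involution: `revflip(π)(i) = n + 1 − π(n + 1 − i)` (1-based). -/
def revflip {n : ℕ} (π : Equiv.Perm (Fin n)) : Equiv.Perm (Fin n) :=
  (Fin.revPerm.trans π).trans Fin.revPerm

/-- Containment of `231`, in terms of three positions. -/
lemma pattern3_pat231_iff {n : ℕ} (π : Equiv.Perm (Fin n)) :
    Pattern3 pat231 π ↔ ∃ i j k, i < j ∧ j < k ∧ π k < π i ∧ π i < π j := by
  constructor
  · rintro ⟨f, hf, h⟩
    exact ⟨f 0, f 1, f 2, hf (by decide), hf (by decide),
      (h 2 0).1 (by decide), (h 0 1).1 (by decide)⟩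
  · rintro ⟨i, j, k, hij, hjk, h₁, h₂⟩
    have h₃ := h₁.trans h₂
    refine ⟨![i, j, k], ?_, ?_⟩
    · intro a b hab
      fin_cases a <;> fin_cases b <;> simp_all [hij.trans hjk]
    · have e0 : pat231 0 = 1 := by decide
      have e1 : pat231 1 = 2 := by decide
      have e2 : pat231 2 = 0 := by decide
      intro a b
      fin_cases a <;> fin_cases b <;> simp [e0, e1, e2, h₁, h₂, h₃, h₁.le, h₂.le, h₃.le]

/-- Containment of `132`, in terms of three positions. -/
lemma pattern3_pat132_iff {n : ℕ} (π : Equiv.Perm (Fin n)) :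
    Pattern3 pat132 π ↔ ∃ i j k, i < j ∧ j < k ∧ π i < π k ∧ π k < π j := by
  constructor
  · rintro ⟨f, hf, h⟩
    exact ⟨f 0, f 1, f 2, hf (by decide), hf (by decide),
      (h 0 2).1 (by decide), (h 2 1).1 (by decide)⟩
  · rintro ⟨i, j, k, hij, hjk, h₁, h₂⟩
    have h₃ := h₁.trans h₂
    refine ⟨![i, j, k], ?_, ?_⟩
    · intro a b hab
      fin_cases a <;> fin_cases b <;> simp_all [hij.trans hjk]
    · have e0 : pat132 0 = 0 := by decide
      have e1 : pat132 1 = 2 := by decide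
      have e2 : pat132 2 = 1 := by decide
      intro a b
      fin_cases a <;> fin_cases b <;> simp [e0, e1, e2, h₁, h₂, h₃, h₁.le, h₂.le, h₃.le]

/-- The word of `π` has no interior peak, even among non-consecutive positions. -/
def NoPeak {n : ℕ} (π : Equiv.Perm (Fin n)) : Prop :=
  ∀ i j k, i < j → j < k → π j < π i ∨ π j < π k

lemma avoids_231_132_iff {n : ℕ} (π : Equiv.Perm (Fin n)) :
    (¬ Pattern3 pat231 π ∧ ¬ Pattern3 pat132 π) ↔ NoPeak π := by
  rw [pattern3_pat231_iff, pattern3_pat132_iff]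
  constructor
  · rintro ⟨h₁, h₂⟩ i j k hij hjk
    by_contra! h
    have hi : π i < π j := lt_of_le_of_ne h.1 (π.injective.ne hij.ne)
    have hk : π k < π j := lt_of_le_of_ne h.2 (π.injective.ne hjk.ne')
    rcases lt_or_gt_of_ne (π.injective.ne (hij.trans hjk).ne) with hik | hik
    · exact h₂ ⟨i, j, k, hij, hjk, hik, hk⟩
    · exact h₁ ⟨i, j, k, hij, hjk, hik, hi⟩
  · intro h
    constructor
    · rintro ⟨i, j, k, hij, hjk, h₁, h₂⟩
      rcases h i j k hij hjk with h' | h'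
      · exact h'.asymm h₂
      · exact h'.asymm (h₁.trans h₂)
    · rintro ⟨i, j, k, hij, hjk, h₁, h₂⟩
      rcases h i j k hij hjk with h' | h'
      · exact h'.asymm (h₁.trans h₂)
      · exact h'.asymm h₂

/-- The parity-alternating permutations without interior peaks. -/
def peaklessPAP (n : ℕ) : Set (Equiv.Perm (Fin n)) :=
  {π | ModKAlt 2 π ∧ NoPeak π}

lemma mpPat2_eq_ncard (n : ℕ) : mpPat2 2 pat231 pat132 n = (peaklessPAP n).ncard := by
  simp only [mpPat2, avoids_231_132_iff]
  exact Nat.card_coe_set_eq (peaklessPAP n)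

/-- Without interior peaks, the maximum sits at one of the two ends. -/
lemma NoPeak.map_zero_or_map_last {n : ℕ} {π : Equiv.Perm (Fin (n + 1))} (h : NoPeak π) :
    π 0 = Fin.last n ∨ π (Fin.last n) = Fin.last n := by
  obtain ⟨j, hj⟩ := π.surjective (Fin.last n)
  rcases eq_or_ne j 0 with rfl | h0
  · exact .inl hj
  rcases eq_or_ne j (Fin.last n) with rfl | hl
  · exact .inr hj
  have := h 0 j (Fin.last n) (Fin.pos_iff_ne_zero.2 h0) (Fin.lt_last_iff_ne_last.2 hl)
  simp [hj, Fin.not_lt.2 (Fin.le_last _)] at this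

/-- Extend a permutation of `Fin n` to one of `Fin (n + 1)` fixing the last element. -/
def extendLast {n : ℕ} (e : Equiv.Perm (Fin n)) : Equiv.Perm (Fin (n + 1)) :=
  finSuccEquivLast.trans ((Equiv.optionCongr e).trans finSuccEquivLast.symm)

@[simp] lemma extendLast_castSucc {n : ℕ} (e : Equiv.Perm (Fin n)) (i : Fin n) :
    extendLast e i.castSucc = (e i).castSucc := by
  simp [extendLast]

@[simp] lemma extendLast_last {n : ℕ} (e : Equiv.Perm (Fin n)) :
    extendLast e (Fin.last n) = Fin.last n := by
  simp [extendLast]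

lemma extendLast_injective (n : ℕ) : Function.Injective (extendLast (n := n)) := by
  intro e e' h
  ext i
  have := congrArg (fun π => ((π i.castSucc : Fin (n + 1)) : ℕ)) h
  simpa using this

lemma exists_extendLast_eq {n : ℕ} {π : Equiv.Perm (Fin (n + 1))}
    (h : π (Fin.last n) = Fin.last n) : ∃ e, extendLast e = π := by
  have hne (i : Fin n) : π i.castSucc ≠ Fin.last n := fun hi =>
    (Fin.castSucc_lt_last i).ne (π.injective (hi.trans h.symm))
  have hinj : Function.Injective fun i : Fin n => (π i.castSucc).castPred (hne i) := by
    intro i j hij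
    simpa using hij
  refine ⟨Equiv.ofBijective _ (Finite.injective_iff_bijective.1 hinj), ?_⟩
  ext i
  induction i using Fin.lastCases with
  | last => simp [h]
  | cast i => simp

lemma extendLast_mem_peaklessPAP_iff {n : ℕ} (e : Equiv.Perm (Fin n)) :
    extendLast e ∈ peaklessPAP (n + 1) ↔ e ∈ peaklessPAP n := by
  constructor
  · rintro ⟨hpar, hpeak⟩
    refine ⟨fun i => by simpa using hpar i.castSucc, fun i j k hij hjk => ?_⟩
    simpa using hpeak i.castSucc j.castSucc k.castSucc (by simpa) (by simpa)
  · rintro ⟨hpar, hpeak⟩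
    refine ⟨fun i => ?_, fun i j k hij hjk => ?_⟩
    · induction i using Fin.lastCases with
      | last => simp
      | cast i => simpa using hpar i
    · obtain ⟨j, rfl⟩ := Fin.exists_castSucc_eq.2 (hjk.trans_le (Fin.le_last k)).ne
      obtain ⟨i, rfl⟩ := Fin.exists_castSucc_eq.2 (hij.trans (Fin.castSucc_lt_last j)).ne
      induction k using Fin.lastCases with
      | last => exact .inr (by simp [Fin.castSucc_lt_last])
      | cast k => simpa using hpeak i j k (by simpa using hij) (by simpa using hjk)

lemma ncard_peaklessPAP_map_last (n : ℕ) :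
    {π ∈ peaklessPAP (n + 1) | π (Fin.last n) = Fin.last n}.ncard = (peaklessPAP n).ncard := by
  rw [← Set.ncard_image_of_injective _ (extendLast_injective n)]
  congr 1
  ext π
  constructor
  · rintro ⟨hπ, hlast⟩
    obtain ⟨e, rfl⟩ := exists_extendLast_eq hlast
    exact ⟨e, (extendLast_mem_peaklessPAP_iff e).1 hπ, rfl⟩
  · rintro ⟨e, he, rfl⟩
    exact ⟨(extendLast_mem_peaklessPAP_iff e).2 he, extendLast_last e⟩

/-- Reversing the word preserves parity alternation when the length is odd. -/
lemma revPerm_trans_mem_peaklessPAP {m : ℕ} {π : Equiv.Perm (Fin (2 * m + 1))}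
    (h : π ∈ peaklessPAP (2 * m + 1)) : Fin.revPerm.trans π ∈ peaklessPAP (2 * m + 1) := by
  refine ⟨fun i => ?_, fun i j k hij hjk => ?_⟩
  · have := h.1 i.rev
    simp only [Equiv.trans_apply, Fin.revPerm_apply, Fin.val_rev] at this ⊢
    omega
  · exact (h.2 k.rev j.rev i.rev (Fin.rev_lt_rev.2 hjk) (Fin.rev_lt_rev.2 hij)).symm

lemma ncard_peaklessPAP_map_zero (m : ℕ) :
    {π ∈ peaklessPAP (2 * m + 1) | π 0 = Fin.last (2 * m)}.ncard =
      {π ∈ peaklessPAP (2 * m + 1) | π (Fin.last (2 * m)) = Fin.last (2 * m)}.ncard := by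
  refine Set.ncard_congr (fun π _ => Fin.revPerm.trans π) ?_ ?_ ?_
  · rintro π ⟨hπ, h0⟩
    exact ⟨revPerm_trans_mem_peaklessPAP hπ, by simpa using h0⟩
  · intro π ρ _ _ h
    ext i
    simpa using congrArg (fun σ => ((σ i.rev : Fin (2 * m + 1)) : ℕ)) h
  · rintro π ⟨hπ, hlast⟩
    refine ⟨Fin.revPerm.trans π, ⟨revPerm_trans_mem_peaklessPAP hπ, by simpa using hlast⟩, ?_⟩
    ext i
    simp

lemma ncard_peaklessPAP_even (m : ℕ) :
    (peaklessPAP (2 * m + 2)).ncard = (peaklessPAP (2 * m + 1)).ncard := by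
  rw [← ncard_peaklessPAP_map_last (2 * m + 1)]
  congr 1
  ext π
  refine ⟨fun hπ => ⟨hπ, hπ.2.map_zero_or_map_last.resolve_left fun h0 => ?_⟩, And.left⟩
  have := hπ.1 0
  rw [h0] at this
  simp at this

lemma ncard_peaklessPAP_odd (m : ℕ) :
    (peaklessPAP (2 * m + 3)).ncard = 2 * (peaklessPAP (2 * m + 2)).ncard := by
  have hsplit : peaklessPAP (2 * m + 3) =
      {π ∈ peaklessPAP (2 * m + 3) | π 0 = Fin.last (2 * m + 2)} ∪
        {π ∈ peaklessPAP (2 * m + 3) | π (Fin.last (2 * m + 2)) = Fin.last (2 * m + 2)} := by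
    ext π
    simp only [Set.mem_union, Set.mem_sep_iff, ← and_or_left]
    exact ⟨fun hπ => ⟨hπ, hπ.2.map_zero_or_map_last⟩, And.left⟩
  have hdisj : Disjoint {π ∈ peaklessPAP (2 * m + 3) | π 0 = Fin.last (2 * m + 2)}
      {π ∈ peaklessPAP (2 * m + 3) | π (Fin.last (2 * m + 2)) = Fin.last (2 * m + 2)} := by
    rw [Set.disjoint_left]
    rintro π ⟨_, h0⟩ ⟨_, hlast⟩
    exact absurd (congrArg Fin.val (π.injective (h0.trans hlast.symm))) (by simp)
  rw [hsplit, Set.ncard_union_eq hdisj, ← ncard_peaklessPAP_map_last (2 * m + 2),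
    two_mul (Set.ncard _)]
  exact congrArg (· + _) (ncard_peaklessPAP_map_zero (m + 1))

lemma ncard_peaklessPAP_one : (peaklessPAP 1).ncard = 1 := by
  rw [Set.ncard_eq_one]
  refine ⟨1, Set.eq_singleton_iff_unique_mem.2 ⟨⟨fun i => rfl, fun i j k hij _ => ?_⟩,
    fun π _ => Subsingleton.elim _ _⟩⟩
  exact absurd (Subsingleton.elim i j) hij.ne

lemma ncard_peaklessPAP_two_mul_add_one (m : ℕ) : (peaklessPAP (2 * m + 1)).ncard = 2 ^ m := by
  induction m with
  | zero => exact ncard_peaklessPAP_one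
  | succ m ih =>
    rw [show 2 * (m + 1) + 1 = 2 * m + 3 by ring, ncard_peaklessPAP_odd,
      ncard_peaklessPAP_even, ih, pow_succ']

theorem pap_231_132_count :
    (∀ m : ℕ, 1 ≤ m → mpPat2 2 pat231 pat132 (2 * m) = 2 ^ (m - 1)) ∧
    (∀ m : ℕ, mpPat2 2 pat231 pat132 (2 * m + 1) = 2 ^ m) := by
  refine ⟨fun m hm => ?_, fun m => ?_⟩
  · obtain ⟨m, rfl⟩ := Nat.exists_eq_add_of_le' hm
    rw [mpPat2_eq_ncard, show 2 * (m + 1) = 2 * m + 2 by ring, ncard_peaklessPAP_even,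
      ncard_peaklessPAP_two_mul_add_one, Nat.add_sub_cancel]
  · rw [mpPat2_eq_ncard, ncard_peaklessPAP_two_mul_add_one]
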